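/- arXiv:1001.5379 — 2 statements merged into one kernel-verified Lean document; each statement's English description precedes it below -/
import Mathlib

section
/- Let Γ be a finite digraph and suppose x ≺ y ≺ z in the path poset P(Γ), where ≺ denotes the covering relation. Then there exists a unique y′ ∈ P(Γ) with y′ ≠ y such that x ≺ y′ ≺ z. -/
set_option autoImplicit false

/-- A finite directed graph: finite sets of vertices and edges with tail and head maps. -/
structure Digr where
  V : Type
  E : Type
  [fintV : Fintype V]
  [decV : DecidableEq V]
  [fintE : Fintype E]
  [decE : DecidableEq E]
  t : E → V
  h : E → V

attribute [instance] Digr.fintV Digr.decV Digr.fintE Digr.decE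

namespace Digr

/-- A set of edges `S` is a multipath if every vertex is the tail of at most one edge of `S`
and the head of at most one edge of `S`, and `S` contains no directed cycle. -/
def IsMultipath (Γ : Digr) (S : Set Γ.E) : Prop :=
  (∀ e₁ e₂, e₁ ∈ S → e₂ ∈ S → Γ.t e₁ = Γ.t e₂ → e₁ = e₂) ∧
  (∀ e₁ e₂, e₁ ∈ S → e₂ ∈ S → Γ.h e₁ = Γ.h e₂ → e₁ = e₂) ∧
  ¬ ∃ (k : ℕ) (c : Fin (k + 1) → Γ.E), (∀ i, c i ∈ S) ∧
      (∀ i : Fin k, Γ.h (c i.castSucc) = Γ.t (c i.succ)) ∧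
      Γ.h (c (Fin.last k)) = Γ.t (c 0)

/-- The path poset of a digraph: multipaths ordered by inclusion. -/
def PathPoset (Γ : Digr) : Type := { S : Set Γ.E // Γ.IsMultipath S }

instance (Γ : Digr) : PartialOrder (PathPoset Γ) :=
  inferInstanceAs (PartialOrder { S : Set Γ.E // Γ.IsMultipath S })

end Digr

namespace Digr

variable {Γ : Digr}

theorem IsMultipath.mono {S T : Set Γ.E} (hT : Γ.IsMultipath T) (hST : S ⊆ T) :
    Γ.IsMultipath S := by
  obtain ⟨ht, hh, hc⟩ := hT
  refine ⟨fun e₁ e₂ h₁ h₂ => ht e₁ e₂ (hST h₁) (hST h₂),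
    fun e₁ e₂ h₁ h₂ => hh e₁ e₂ (hST h₁) (hST h₂), ?_⟩
  rintro ⟨k, c, hcS, hc'⟩
  exact hc ⟨k, c, fun i => hST (hcS i), hc'⟩

/-- Covering relations in the path poset are given by adding a single edge. -/
theorem PathPoset.covBy_iff_exists_insert {x y : PathPoset Γ} :
    x ⋖ y ↔ ∃ a ∉ x.1, insert a x.1 = y.1 := by
  rw [← Set.covBy_iff_exists_insert]
  refine (Set.OrdConnected.apply_covBy_apply_iff
    (OrderEmbedding.subtype fun S : Set Γ.E => Γ.IsMultipath S) ?_).symm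
  refine ⟨?_⟩
  rintro _ - _ ⟨T, rfl⟩ S hS
  exact ⟨⟨S, T.2.mono hS.2⟩, rfl⟩

end Digr

open Digr in
/-- The diamond property of the path poset: if `x ≺ y ≺ z` then there is a unique
`y' ≠ y` with `x ≺ y' ≺ z`. -/
theorem diamond_pathPoset (Γ : Digr) (x y z : Digr.PathPoset Γ)
    (hxy : x ⋖ y) (hyz : y ⋖ z) :
    ∃! y' : Digr.PathPoset Γ, y' ≠ y ∧ x ⋖ y' ∧ y' ⋖ z := by
  obtain ⟨a, hax, hay⟩ := PathPoset.covBy_iff_exists_insert.1 hxy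
  obtain ⟨b, hby, hbz⟩ := PathPoset.covBy_iff_exists_insert.1 hyz
  rw [← hay] at hby hbz
  rw [Set.mem_insert_iff, not_or] at hby
  obtain ⟨hba, hbx⟩ := hby
  rw [Set.insert_comm] at hbz
  refine ⟨⟨insert b x.1, z.2.mono (hbz ▸ Set.subset_insert _ _)⟩, ⟨?_, ?_, ?_⟩, ?_⟩
  · intro h
    have hb : b ∈ y.1 := h ▸ Set.mem_insert b x.1
    rw [← hay] at hb
    exact hb.elim hba hbx
  · exact PathPoset.covBy_iff_exists_insert.2 ⟨b, hbx, rfl⟩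
  · exact PathPoset.covBy_iff_exists_insert.2
      ⟨a, fun h => h.elim (fun h => hba h.symm) hax, hbz⟩
  · rintro w ⟨hwy, hxw, hwz⟩
    obtain ⟨c, hcx, hcw⟩ := PathPoset.covBy_iff_exists_insert.1 hxw
    have hcz : c ∈ z.1 := hwz.le (hcw ▸ Set.mem_insert c x.1)
    rw [← hbz] at hcz
    rcases hcz with rfl | rfl | hc
    · exact absurd (Subtype.ext (hcw.symm.trans hay)) hwy
    · exact Subtype.ext hcw.symm
    · exact absurd hc hcx
end

section
/- Let Γ be a finite digraph, x ∈ P(Γ) a multipath, and e an edge of Γ with e ∉ x such that x ∪ {e} is again a multipath. Then the tail t(e) and the head h(e) of e lie in distinct weakly connected components of the spanning subgraph Γ_x = (V, x); that is, there is no walk in the underlying undirected graph of (V, x) joining t(e) to h(e). -/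
set_option autoImplicit false

namespace Digr

/-- `u` and `v` are joined by an edge of `x`, in the underlying undirected sense. -/
def WAdj (Γ : Digr) (x : Set Γ.E) (u v : Γ.V) : Prop :=
  ∃ e ∈ x, (Γ.t e = u ∧ Γ.h e = v) ∨ (Γ.t e = v ∧ Γ.h e = u)

end Digr

namespace Digr

/-- `u` and `v` are joined by an edge of `x` directed from `u` to `v`. -/
def DAdj (Γ : Digr) (x : Set Γ.E) (u v : Γ.V) : Prop :=
  ∃ f ∈ x, Γ.t f = u ∧ Γ.h f = v

/-- An edge followed by a directed walk can be listed as a sequence of composable edges. -/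
theorem exists_edge_sequence_of_reflTransGen {Γ : Digr} {S : Set Γ.E} {e : Γ.E} (he : e ∈ S)
    {v : Γ.V} (hv : Relation.ReflTransGen (DAdj Γ S) (Γ.h e) v) :
    ∃ (k : ℕ) (c : Fin (k + 1) → Γ.E), (∀ i, c i ∈ S) ∧
      (∀ i : Fin k, Γ.h (c i.castSucc) = Γ.t (c i.succ)) ∧
      c 0 = e ∧ Γ.h (c (Fin.last k)) = v := by
  induction hv with
  | refl => exact ⟨0, fun _ => e, fun _ => he, fun i => i.elim0, rfl, rfl⟩
  | tail _ hstep ih =>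
    obtain ⟨k, c, hmem, hchain, hzero, hlast⟩ := ih
    obtain ⟨f, hf, htail, hhead⟩ := hstep
    refine ⟨k + 1, Fin.snoc (α := fun _ => Γ.E) c f, fun i => ?_, fun i => ?_, ?_, ?_⟩
    · induction i using Fin.lastCases with
      | last => simpa using hf
      | cast j => simpa using hmem j
    · induction i using Fin.lastCases with
      | last => simp [Fin.succ_last, hlast, htail]
      | cast j => simpa only [Fin.succ_castSucc, Fin.snoc_castSucc] using hchain j
    · rw [← Fin.castSucc_zero, Fin.snoc_castSucc, hzero]
    · simpa using hhead

/-- No directed walk in a multipath leads from the head of one of its edges back to the tail. -/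
theorem IsMultipath.not_reflTransGen_head_tail {Γ : Digr} {S : Set Γ.E} (hS : Γ.IsMultipath S)
    {e : Γ.E} (he : e ∈ S) : ¬ Relation.ReflTransGen (DAdj Γ S) (Γ.h e) (Γ.t e) := by
  intro hwalk
  obtain ⟨k, c, hmem, hchain, hzero, hlast⟩ := exists_edge_sequence_of_reflTransGen he hwalk
  exact hS.2.2 ⟨k, c, hmem, hchain, by rw [hlast, hzero]⟩

/-- If edges of `x` are determined by their tails and `u` is the tail of no edge of `x`, every
vertex weakly connected to `u` has a directed walk to `u`. -/
theorem reflTransGen_dAdj_of_wAdj {Γ : Digr} {x : Set Γ.E}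
    (hx : ∀ e₁ e₂, e₁ ∈ x → e₂ ∈ x → Γ.t e₁ = Γ.t e₂ → e₁ = e₂) {u v : Γ.V}
    (hu : ∀ f ∈ x, Γ.t f ≠ u) (huv : Relation.ReflTransGen (WAdj Γ x) u v) :
    Relation.ReflTransGen (DAdj Γ x) v u := by
  induction huv with
  | refl => exact .refl
  | tail _ hstep ih =>
    obtain ⟨f, hf, ⟨htail, hhead⟩ | ⟨htail, hhead⟩⟩ := hstep
    · rcases ih.cases_head with heq | ⟨w, ⟨g, hg, hgtail, hghead⟩, hw⟩
      · exact absurd (htail.trans heq) (hu f hf)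
      · obtain rfl := hx f g hf hg (htail.trans hgtail.symm)
        rwa [← hhead, hghead]
    · exact ih.head ⟨f, hf, htail, hhead⟩

end Digr

open Digr in
/-- If `x` is a multipath, `e ∉ x` and `x ∪ {e}` is again a multipath, then the tail and the
head of `e` lie in distinct weakly connected components of the spanning subgraph `(V, x)`:
there is no undirected walk in `(V, x)` from `t e` to `h e`. -/
theorem tail_head_in_distinct_components (Γ : Digr) (x : Set Γ.E)
    (hx : Γ.IsMultipath x) (e : Γ.E) (he : e ∉ x)
    (hy : Γ.IsMultipath (insert e x)) :
    ¬ Relation.ReflTransGen (Digr.WAdj Γ x) (Γ.t e) (Γ.h e) := by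
  intro hwalk
  have hu : ∀ f ∈ x, Γ.t f ≠ Γ.t e := fun f hf heq =>
    he (hy.1 f e (Set.mem_insert_of_mem e hf) (Set.mem_insert e x) heq ▸ hf)
  refine hy.not_reflTransGen_head_tail (Set.mem_insert e x)
    (Relation.ReflTransGen.mono ?_ _ _ (reflTransGen_dAdj_of_wAdj hx.1 hu hwalk))
  rintro _ _ ⟨f, hf, hends⟩
  exact ⟨f, Set.mem_insert_of_mem e hf, hends⟩
end
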